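/- Let k ≥ 1 be an integer and let a < 0 < b be reals with b/|a| ∈ (A_k, A_{k+1}). Then with positive probability the walk driven by D^{a,b} eventually remains in a set of k+2 consecutive sites and visits each of these k+2 sites infinitely often; that is, with positive probability there exist x ∈ ℤ and n₀ ≥ 0 such that X_n ∈ {x, x+1, …, x+k+1} for all n ≥ n₀, and each of the sites x, x+1, …, x+k+1 is visited by (X_n) infinitely often. -/

import Mathlib

open MeasureTheory Real Filter Set

noncomputable section

/-- Number of crossings of the edge `{e, e+1}` (i.e. the half-integer edge `e + 1/2`)
before time `n`. -/
def locTime {Ω : Type*} (X : ℕ → Ω → ℤ) (n : ℕ) (e : ℤ) (ω : Ω) : ℕ :=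
  ((Finset.range n).filter fun m => min (X m ω) (X (m + 1) ω) = e).card

/-- Local time profile seen from the walker: `ℓ_n(k + 1/2)`. -/
def shiftedProfile {Ω : Type*} (X : ℕ → Ω → ℤ) (n : ℕ) (k : ℤ) (ω : Ω) : ℕ :=
  locTime X n (X n ω + k) ω

/-- `F(y) = e^y / (e^y + e^{-y})`. -/
def walkF (y : ℝ) : ℝ := Real.exp y / (Real.exp y + Real.exp (-y))

/-- The σ-algebra generated by `X_0, …, X_n`. -/
def walkFiltration {Ω : Type*} (X : ℕ → Ω → ℤ) (n : ℕ) : MeasurableSpace Ω :=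
  ⨆ m ∈ Finset.range (n + 1), MeasurableSpace.comap (X m) inferInstance

/-- The drift `D^{a,b}(ℓ_n) = a ℓ_n(-3/2) + b ℓ_n(-1/2) - b ℓ_n(1/2) - a ℓ_n(3/2)`,
with the half-integer edge `k + 1/2` encoded by the integer `k`. -/
def Dab {Ω : Type*} (a b : ℝ) (X : ℕ → Ω → ℤ) (n : ℕ) (ω : Ω) : ℝ :=
  a * shiftedProfile X n (-2) ω + b * shiftedProfile X n (-1) ω
    - b * shiftedProfile X n 0 ω - a * shiftedProfile X n 1 ω

/-- `A_k = 1 + 2 cos(2π/(k+2))`. -/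
def A (k : ℕ) : ℝ := 1 + 2 * Real.cos (2 * Real.pi / (k + 2))

lemma ZMod.dft_sum_stdAddChar_mul {N : ℕ} [NeZero N] (f : ZMod N → ℝ) (d : ZMod N) :
    ∑ m : ZMod N, (ZMod.stdAddChar (d * m)).re * ‖ZMod.dft (fun j => (f j : ℂ)) m‖ ^ 2
      = N * ∑ j, f j * f (j + d) := by
  set g : ZMod N → ℂ := fun j => (f j : ℂ) with hg
  have hinv (j : ZMod N) :
      ∑ m : ZMod N, ZMod.stdAddChar (m * j) * ZMod.dft g m = N * g j := by
    have h := congrFun (ZMod.dft.symm_apply_apply g) j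
    rw [ZMod.invDFT_apply] at h
    rw [← h, smul_eq_mul, mul_inv_cancel_left₀ (NeZero.ne _)]
    simp
  have hconj (m : ZMod N) : ∑ j : ZMod N, ZMod.stdAddChar (m * j) * g j
      = (starRingEnd ℂ) (ZMod.dft g m) := by
    rw [ZMod.dft_apply, map_sum]
    refine Finset.sum_congr rfl fun j _ => ?_
    rw [smul_eq_mul, map_mul (starRingEnd ℂ), ← AddChar.map_neg_eq_conj, neg_neg, mul_comm m j]
    simp [hg]
  have key : ∑ m : ZMod N, ZMod.stdAddChar (d * m) * ((‖ZMod.dft g m‖ ^ 2 : ℝ) : ℂ)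
      = N * ∑ j, g j * g (j + d) := by
    calc _ = ∑ m : ZMod N, ∑ j, ZMod.stdAddChar (m * (j + d)) * ZMod.dft g m * g j := by
          refine Finset.sum_congr rfl fun m _ => ?_
          rw [Complex.ofReal_pow, ← Complex.mul_conj', ← hconj, Finset.mul_sum, Finset.mul_sum]
          refine Finset.sum_congr rfl fun j _ => ?_
          rw [mul_add, AddChar.map_add_eq_mul, mul_comm d m]
          ring
      _ = _ := by
          rw [Finset.sum_comm, Finset.mul_sum]
          refine Finset.sum_congr rfl fun j _ => ?_
          rw [← Finset.sum_mul, hinv]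
          ring
  have := congrArg Complex.re key
  simp only [hg, ← Complex.ofReal_mul, ← Complex.ofReal_sum, ← Complex.ofReal_natCast,
    Complex.ofReal_re, Complex.re_sum, Complex.re_mul_ofReal] at this
  exact this

lemma ZMod.re_stdAddChar_le {N : ℕ} [NeZero N] {m : ZMod N} (hm : m ≠ 0) :
    (ZMod.stdAddChar m).re ≤ Real.cos (2 * π / N) := by
  have hN : (0 : ℝ) < N := by exact_mod_cast NeZero.pos N
  have h1 : 1 ≤ m.val := Nat.one_le_iff_ne_zero.2 (by simpa using hm)
  have h2 : m.val + 1 ≤ N := m.val_lt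
  have hre : (ZMod.stdAddChar m).re = Real.cos (2 * π * m.val / N) := by
    have : ZMod.stdAddChar m = Complex.exp ((2 * π * m.val / N : ℝ) * Complex.I) := by
      conv_lhs => rw [← ZMod.natCast_zmod_val m, ← Int.cast_natCast, ZMod.stdAddChar_coe]
      congr 1
      push_cast
      ring
    rw [this, Complex.exp_ofReal_mul_I_re]
  rw [hre]
  have h1' : (1 : ℝ) ≤ m.val := by exact_mod_cast h1
  have h2' : (m.val : ℝ) + 1 ≤ N := by exact_mod_cast h2
  have hpi := Real.pi_pos
  rcases le_total (2 * π * m.val / N) π with h | h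
  · refine Real.cos_le_cos_of_nonneg_of_le_pi (by positivity) h ?_
    exact div_le_div_of_nonneg_right (le_mul_of_one_le_right (by positivity) h1') hN.le
  · rw [← Real.cos_two_pi_sub (2 * π * m.val / N)]
    refine Real.cos_le_cos_of_nonneg_of_le_pi (by positivity) (by linarith) ?_
    rw [div_le_iff₀ hN, sub_mul, div_mul_cancel₀ _ hN.ne']
    nlinarith

/-- Discrete Wirtinger inequality on the cycle. -/
lemma ZMod.sum_mul_shift_le {N : ℕ} [NeZero N] (f : ZMod N → ℝ) (hf : ∑ j, f j = 0) :
    ∑ j, f j * f (j + 1) ≤ Real.cos (2 * π / N) * ∑ j, f j ^ 2 := by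
  have hN : (0 : ℝ) < N := by exact_mod_cast NeZero.pos N
  have h0 := ZMod.dft_sum_stdAddChar_mul f 0
  have h1 := ZMod.dft_sum_stdAddChar_mul f 1
  simp only [zero_mul, AddChar.map_zero_eq_one, Complex.one_re, one_mul, add_zero, ← sq] at h0 h1
  refine le_of_mul_le_mul_left ?_ hN
  rw [← h1, mul_left_comm, ← h0, Finset.mul_sum]
  refine Finset.sum_le_sum fun m _ => ?_
  rcases eq_or_ne m 0 with rfl | hm
  · have : ZMod.dft (fun j => (f j : ℂ)) 0 = 0 := by
      rw [ZMod.dft_apply_zero, ← Complex.ofReal_sum, hf, Complex.ofReal_zero]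
    simp [this]
  · exact mul_le_mul_of_nonneg_right (ZMod.re_stdAddChar_le hm) (sq_nonneg _)

lemma sum_mul_succ_le (N : ℕ) (hN : 0 < N) (f : ℕ → ℝ) (hf : ∑ j ∈ Finset.range N, f j = 0)
    (hlast : f (N - 1) = 0) :
    ∑ j ∈ Finset.range N, f j * f (j + 1)
      ≤ Real.cos (2 * π / N) * ∑ j ∈ Finset.range N, f j ^ 2 := by
  obtain ⟨M, rfl⟩ : ∃ M, N = M + 1 := ⟨N - 1, by omega⟩
  rw [Nat.add_sub_cancel] at hlast
  have hs (g : ZMod (M + 1) → ℝ) : ∑ j, g j = ∑ j ∈ Finset.range (M + 1), g (j : ℕ) := by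
    rw [Finset.sum_range]
    refine Finset.sum_congr rfl fun j _ => ?_
    congr 1
    exact (ZMod.natCast_zmod_val (n := M + 1) j).symm
  have hv {j : ℕ} (hj : j ∈ Finset.range (M + 1)) : ((j : ZMod (M + 1))).val = j :=
    ZMod.val_cast_of_lt (Finset.mem_range.1 hj)
  have h := ZMod.sum_mul_shift_le (N := M + 1) (fun j => f j.val) (by
    rw [hs, ← hf]
    exact Finset.sum_congr rfl fun j hj => by rw [hv hj])
  rw [hs, hs] at h
  convert h using 1
  · refine Finset.sum_congr rfl fun j hj => ?_
    rw [hv hj]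
    rcases Nat.lt_succ_iff_lt_or_eq.1 (Finset.mem_range.1 hj) with hlt | rfl
    · rw [← Nat.cast_succ, hv (Finset.mem_range.2 (Nat.succ_lt_succ hlt))]
    · rw [hlast, zero_mul, zero_mul]
  · congr 1
    exact Finset.sum_congr rfl fun j hj => by rw [hv hj]

/-- The gradient at edge `e` of the interaction energy of the profile `u`. -/
def stencil (a b : ℝ) (u : ℤ → ℝ) (e : ℤ) : ℝ := a * u (e - 1) + (a + b) * u e + a * u (e + 1)

/-- The drift felt by a walker at site `j` in the profile `u`. -/
def siteDrift (a b : ℝ) (u : ℤ → ℝ) (j : ℤ) : ℝ :=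
  a * u (j - 2) + b * u (j - 1) - b * u j - a * u (j + 1)

lemma siteDrift_eq_stencil_sub (a b : ℝ) (u : ℤ → ℝ) (j : ℤ) :
    siteDrift a b u j = stencil a b u (j - 1) - stencil a b u j := by
  unfold siteDrift stencil
  rw [show j - 1 - 1 = j - 2 by ring, sub_add_cancel]
  ring

/-- Twice the interaction energy of the profile `u` on the edges `0, …, k`. -/
def energy (a b : ℝ) (k : ℕ) (u : ℤ → ℝ) : ℝ :=
  ∑ i ∈ Finset.range (k + 2), u i * stencil a b u i

lemma sum_mul_stencil_comm (a b : ℝ) (k : ℕ) (u v : ℤ → ℝ) (hu : u (-1) = 0)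
    (hu' : u (k + 1) = 0) (hv : v (-1) = 0) (hv' : v (k + 1) = 0) :
    ∑ i ∈ Finset.range (k + 2), u i * stencil a b v i
      = ∑ i ∈ Finset.range (k + 2), v i * stencil a b u i := by
  rw [← sub_eq_zero, ← Finset.sum_sub_distrib]
  have h := Finset.sum_range_sub' (fun i : ℕ => u i * v (i - 1) - u (i - 1) * v i) (k + 2)
  have h0 : ((k + 2 : ℕ) : ℤ) - 1 = k + 1 := by push_cast; ring
  simp only [Nat.cast_zero, zero_sub, hu, hv, h0, hu', hv', mul_zero, zero_mul, sub_zero] at h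
  rw [← mul_zero a, ← h, Finset.mul_sum]
  refine Finset.sum_congr rfl fun i _ => ?_
  unfold stencil
  push_cast
  rw [add_sub_cancel_right]
  ring

lemma stencil_add (a b : ℝ) (u v : ℤ → ℝ) (e : ℤ) :
    stencil a b (u + v) e = stencil a b u e + stencil a b v e := by
  simp only [stencil, Pi.add_apply]
  ring

lemma stencil_smul (a b t : ℝ) (u : ℤ → ℝ) (e : ℤ) :
    stencil a b (t • u) e = t * stencil a b u e := by
  simp only [stencil, Pi.smul_apply, smul_eq_mul]
  ring

lemma energy_add_smul (a b t : ℝ) (k : ℕ) (u v : ℤ → ℝ) (hu : u (-1) = 0)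
    (hu' : u (k + 1) = 0) (hv : v (-1) = 0) (hv' : v (k + 1) = 0) :
    energy a b k (u + t • v) = energy a b k u
      + 2 * t * ∑ i ∈ Finset.range (k + 2), u i * stencil a b v i + t ^ 2 * energy a b k v := by
  have h := sum_mul_stencil_comm a b k u v hu hu' hv hv'
  rw [two_mul, add_mul]
  nth_rw 2 [h]
  simp only [energy, Finset.mul_sum, ← Finset.sum_add_distrib]
  refine Finset.sum_congr rfl fun i _ => ?_
  rw [stencil_add, stencil_smul, Pi.add_apply, Pi.smul_apply, smul_eq_mul]
  ring

lemma sum_single_mul (k : ℕ) (g : ℤ → ℝ) {e : ℤ} (he : 0 ≤ e) (he' : e ≤ k) :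
    ∑ i ∈ Finset.range (k + 2), (Pi.single e 1 : ℤ → ℝ) i * g i = g e := by
  lift e to ℕ using he
  rw [Finset.sum_eq_single_of_mem e (Finset.mem_range.2 (by omega))]
  · simp
  · intro i _ hi
    rw [Pi.single_eq_of_ne (by exact_mod_cast hi), zero_mul]

lemma energy_add_single (a b : ℝ) (k : ℕ) (u : ℤ → ℝ) (hu : u (-1) = 0)
    (hu' : u (k + 1) = 0) {e : ℤ} (he : 0 ≤ e) (he' : e ≤ k) :
    energy a b k (u + Pi.single e 1)
      = energy a b k u + 2 * stencil a b u e + (a + b) := by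
  have h1 : (Pi.single e 1 : ℤ → ℝ) (-1) = 0 := Pi.single_eq_of_ne (by omega) _
  have h2 : (Pi.single e 1 : ℤ → ℝ) (k + 1) = 0 := Pi.single_eq_of_ne (by omega) _
  have h := energy_add_smul a b 1 k u (Pi.single e 1) hu hu' h1 h2
  rw [one_smul] at h
  have h3 : energy a b k (Pi.single e 1) = stencil a b (Pi.single e 1) e :=
    sum_single_mul k _ he he'
  rw [h, sum_mul_stencil_comm a b k u _ hu hu' h1 h2, sum_single_mul k _ he he', h3]
  simp [stencil]

lemma le_energy {a : ℝ} (b : ℝ) (ha : a < 0) (k : ℕ) (v : ℤ → ℝ) (hv : v (-1) = 0)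
    (hv' : v (k + 1) = 0) (hsum : ∑ i ∈ Finset.range (k + 2), v i = 0) :
    (b + a * A k) * ∑ i ∈ Finset.range (k + 2), v i ^ 2 ≤ energy a b k v := by
  have h := sum_mul_succ_le (k + 2) (by omega) (fun i => v i) hsum (by simpa using hv')
  have hE : energy a b k v = (a + b) * ∑ i ∈ Finset.range (k + 2), v i ^ 2
      + 2 * a * ∑ i ∈ Finset.range (k + 2), v i * v (i + 1 : ℕ) := by
    have ht := Finset.sum_range_sub' (fun i : ℕ => v i * v (i - 1)) (k + 2)
    have h0 : ((k + 2 : ℕ) : ℤ) - 1 = k + 1 := by push_cast; ring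
    simp only [Nat.cast_zero, zero_sub, hv, h0, hv', mul_zero, sub_zero] at ht
    rw [← add_zero (_ + _), ← mul_zero a, ← ht, energy]
    simp only [Finset.mul_sum, ← Finset.sum_add_distrib]
    refine Finset.sum_congr rfl fun i _ => ?_
    unfold stencil
    push_cast
    rw [add_sub_cancel_right]
    ring
  rw [hE]
  have hA : b + a * A k = a + b + 2 * a * Real.cos (2 * π / ((k + 2 : ℕ) : ℝ)) := by
    unfold A
    push_cast
    ring
  rw [hA, add_mul, mul_assoc (2 * a)]
  exact add_le_add le_rfl (mul_le_mul_of_nonpos_left h (by linarith))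

/-- A probability profile on the edges `0, …, k` for which the drift vanishes at interior sites
and points inwards at the two extreme sites. -/
structure IsEquilibrium (a b : ℝ) (k : ℕ) (κ : ℝ) (s : ℤ → ℝ) : Prop where
  neg_one : s (-1) = 0
  last : s (k + 1) = 0
  pos : ∀ e : ℤ, 0 ≤ e → e ≤ k → 0 < s e
  sum : ∑ i ∈ Finset.range (k + 2), s i = 1
  stencil_eq : ∀ e, stencil a b s e = κ
  left : 0 < -b * s 0 - a * s 1
  right : 0 < -b * s k - a * s (k - 1)

lemma exists_isEquilibrium {a b : ℝ} (ha : a < 0) {k : ℕ} (hk : 1 ≤ k)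
    (hab : b / |a| ∈ Set.Ioo (A k) (A (k + 1))) : ∃ κ s, IsEquilibrium a b k κ s := by
  have hpi := Real.pi_pos
  have hk' : (1 : ℝ) ≤ k := by exact_mod_cast hk
  have hA1 : Real.cos (2 * π / (k + 2)) < (b / |a| - 1) / 2 := by
    have := hab.1
    unfold A at this
    linarith
  have hA2 : (b / |a| - 1) / 2 < Real.cos (2 * π / (k + 3)) := by
    have := hab.2
    unfold A at this
    push_cast at this
    rw [show (k : ℝ) + 1 + 2 = k + 3 by ring] at this
    linarith
  set t := (b / |a| - 1) / 2 with ht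
  set θ := Real.arccos t with hθ
  have hcos : Real.cos θ = t :=
    Real.cos_arccos ((Real.neg_one_le_cos _).trans hA1.le) (hA2.le.trans (Real.cos_le_one _))
  have h2pos : 0 < 2 * π / (k + 2) := by positivity
  have h3pos : 0 < 2 * π / (k + 3) := by positivity
  have h2le : 2 * π / (k + 2) ≤ π := by
    rw [div_le_iff₀ (by positivity)]
    nlinarith
  have h3le : 2 * π / (k + 3) ≤ π := by
    rw [div_le_iff₀ (by positivity)]
    nlinarith
  have hθ0 : 0 ≤ θ := Real.arccos_nonneg _
  have hθπ : θ ≤ π := Real.arccos_le_pi _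
  have hθ2 : θ < 2 * π / (k + 2) := by
    by_contra! hc
    have := Real.cos_le_cos_of_nonneg_of_le_pi h2pos.le hθπ hc
    linarith
  have hθ3 : 2 * π / (k + 3) < θ := by
    by_contra! hc
    have := Real.cos_le_cos_of_nonneg_of_le_pi hθ0 h3le hc
    linarith
  rw [lt_div_iff₀ (by positivity)] at hθ2
  rw [div_lt_iff₀ (by positivity)] at hθ3
  have hθpos : 0 < θ := by
    by_contra! hc
    nlinarith
  have hb : b = -a * (1 + 2 * Real.cos θ) := by
    rw [hcos, ht, abs_of_neg ha]
    have := ha.ne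
    field_simp
    ring
  set s : ℤ → ℝ := fun e => Real.sin (θ * (e + 1) / 2) * Real.sin (θ * (k + 1 - e) / 2) with hs
  have hs2 (e : ℤ) : s e =
      (Real.cos (θ * e - θ * k / 2) - Real.cos (θ * (k + 2) / 2)) / 2 := by
    rw [Real.cos_sub_cos, hs]
    have h1 : (θ * e - θ * k / 2 + θ * (k + 2) / 2) / 2 = θ * (e + 1) / 2 := by ring
    have h2 : (θ * e - θ * k / 2 - θ * (k + 2) / 2) / 2 = -(θ * (k + 1 - e) / 2) := by ring
    rw [h1, h2, Real.sin_neg]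
    ring
  have hpos (e : ℤ) (he : 0 ≤ e) (he' : e ≤ k) : 0 < s e := by
    have h1 : (0 : ℝ) ≤ e := by exact_mod_cast he
    have h2 : (e : ℝ) ≤ k := by exact_mod_cast he'
    refine mul_pos (Real.sin_pos_of_pos_of_lt_pi ?_ ?_) (Real.sin_pos_of_pos_of_lt_pi ?_ ?_)
    · have : 0 < θ * (e + 1) := mul_pos hθpos (by linarith)
      linarith
    · nlinarith
    · have : 0 < θ * (k + 1 - e) := mul_pos hθpos (by linarith)
      linarith
    · nlinarith
  have hst (e : ℤ) : stencil a b s e = a * -((1 - Real.cos θ) * Real.cos (θ * (k + 2) / 2)) := by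
    unfold stencil
    rw [hs2, hs2, hs2, hb]
    push_cast
    have h1 : θ * (e - 1 : ℝ) - θ * k / 2 = (θ * e - θ * k / 2) - θ := by ring
    have h2 : θ * (e + 1 : ℝ) - θ * k / 2 = (θ * e - θ * k / 2) + θ := by ring
    rw [h1, h2, Real.cos_sub, Real.cos_add]
    ring
  have hout : 0 < Real.sin (θ / 2) * -Real.sin (θ * (k + 3) / 2) := by
    refine mul_pos (Real.sin_pos_of_pos_of_lt_pi (by linarith) (by linarith)) ?_
    rw [neg_pos, ← Real.sin_sub_two_pi]
    refine Real.sin_neg_of_neg_of_neg_pi_lt ?_ ?_ <;> nlinarith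
  have hm1 : s (-1) = 0 := by simp [hs]
  have hk1 : s (k + 1) = 0 := by simp [hs]
  have hm2 : s (-2) = Real.sin (θ / 2) * -Real.sin (θ * (k + 3) / 2) := by
    simp only [hs]
    push_cast
    rw [show θ * (-2 + 1) / 2 = -(θ / 2) by ring,
      show θ * (k + 1 - -2) / 2 = θ * (k + 3) / 2 by ring, Real.sin_neg]
    ring
  have hk2 : s (k + 2) = Real.sin (θ / 2) * -Real.sin (θ * (k + 3) / 2) := by
    simp only [hs]
    push_cast
    rw [show θ * (k + 1 - (k + 2)) / 2 = -(θ / 2) by ring,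
      show θ * (k + 2 + 1 : ℝ) / 2 = θ * (k + 3) / 2 by ring, Real.sin_neg]
    ring
  have hl : 0 < -b * s 0 - a * s 1 := by
    have h := (hst (-1)).trans (hst 0).symm
    unfold stencil at h
    norm_num [hm1] at h
    rw [show -b * s 0 - a * s 1 = -a * s (-2) by linarith, hm2]
    exact mul_pos (by linarith) hout
  have hr : 0 < -b * s k - a * s (k - 1) := by
    have h := (hst k).trans (hst (k + 1)).symm
    unfold stencil at h
    rw [add_sub_cancel_right, show (k : ℤ) + 1 + 1 = k + 2 by ring, hk1] at h
    rw [show -b * s k - a * s (k - 1) = -a * s (k + 2) by linarith, hk2]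
    exact mul_pos (by linarith) hout
  set S := ∑ i ∈ Finset.range (k + 2), s i with hS
  have hSpos : 0 < S := by
    rw [hS, Finset.sum_range_succ]
    have : s ((k + 1 : ℕ) : ℤ) = 0 := by simpa using hk1
    rw [this, add_zero]
    refine Finset.sum_pos (fun i hi => hpos i (by omega) ?_) ⟨0, by simp⟩
    have := Finset.mem_range.1 hi
    omega
  refine ⟨S⁻¹ * (a * -((1 - Real.cos θ) * Real.cos (θ * (k + 2) / 2))), S⁻¹ • s, ?_⟩
  constructor
  · simp [hm1]
  · simp [hk1]
  · intro e he he'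
    exact mul_pos (inv_pos.2 hSpos) (hpos e he he')
  · simp only [Pi.smul_apply, smul_eq_mul, ← Finset.mul_sum, ← hS]
    exact inv_mul_cancel₀ hSpos.ne'
  · intro e
    rw [stencil_smul, hst]
  · have := mul_pos (inv_pos.2 hSpos) hl
    simp only [Pi.smul_apply, smul_eq_mul]
    linarith
  · have := mul_pos (inv_pos.2 hSpos) hr
    simp only [Pi.smul_apply, smul_eq_mul]
    linarith

lemma le_add_of_increment_le (h : ℤ → ℝ) {k e i : ℤ} {B : ℝ} (hB : 0 ≤ B)
    (he0 : 0 ≤ e) (hek : e ≤ k) (hi0 : 0 ≤ i) (hik : i ≤ k)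
    (hl : ∀ m, 1 ≤ m → m ≤ e → h m - h (m - 1) ≤ B)
    (hr : ∀ m, e < m → m ≤ k → h (m - 1) - h m ≤ B) : h e ≤ h i + k * B := by
  have hmono (d : ℤ) (hd : d ≤ k) : (d : ℝ) * B ≤ k * B :=
    mul_le_mul_of_nonneg_right (by exact_mod_cast hd) hB
  rcases le_total e i with hei | hie
  · have key : ∀ i, e ≤ i → i ≤ k → h e ≤ h i + ((i - e : ℤ) : ℝ) * B := by
      intro i hei
      induction i, hei using Int.leInduction with
      | base => simp
      | succ i hei ih =>
        intro hik
        have h1 := ih (by omega)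
        have h2 := hr (i + 1) (by omega) hik
        rw [add_sub_cancel_right] at h2
        push_cast at h1 ⊢
        linarith
    linarith [key i hei hik, hmono (i - e) (by omega)]
  · have key : ∀ m, i ≤ m → m ≤ e → h m ≤ h i + ((m - i : ℤ) : ℝ) * B := by
      intro m him
      induction m, him using Int.leInduction with
      | base => simp
      | succ m him ih =>
        intro hme
        have h1 := ih (by omega)
        have h2 := hl (m + 1) (by omega) hme
        rw [add_sub_cancel_right] at h2
        push_cast at h1 ⊢
        linarith
    linarith [key e hie le_rfl, hmono (e - i) (by omega)]

lemma IsEquilibrium.exists_stencil_le {a b κ : ℝ} {k : ℕ} {s : ℤ → ℝ}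
    (hs : IsEquilibrium a b k κ s) {u : ℤ → ℝ} (hu : u (-1) = 0) (hu' : u (k + 1) = 0) {t : ℝ}
    (hsum : ∑ i ∈ Finset.range (k + 2), u i = t) :
    ∃ i : ℤ, 0 ≤ i ∧ i ≤ k ∧ stencil a b u i ≤ κ * t := by
  by_contra! hc
  have h1 := sum_mul_stencil_comm a b k s u hs.neg_one hs.last hu hu'
  simp only [hs.stencil_eq] at h1
  rw [← Finset.sum_mul, hsum] at h1
  have hzero : s ((k + 1 : ℕ) : ℤ) = 0 := by simpa using hs.last
  have h2 : ∑ i ∈ Finset.range (k + 2), s i * (κ * t) = κ * t := by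
    rw [← Finset.sum_mul, hs.sum, one_mul]
  have h3 : ∑ i ∈ Finset.range (k + 2), s i * (κ * t)
      < ∑ i ∈ Finset.range (k + 2), s i * stencil a b u i := by
    rw [Finset.sum_range_succ, Finset.sum_range_succ _ (k + 1), hzero, zero_mul, zero_mul,
      add_zero, add_zero]
    refine Finset.sum_lt_sum_of_nonempty ⟨0, by simp⟩ fun i hi => ?_
    have hi' := Finset.mem_range.1 hi
    exact mul_lt_mul_of_pos_left (hc i (by omega) (by omega)) (hs.pos i (by omega) (by omega))
  linarith

/-- The state of a walk confined to `0, …, k + 1`: at time `n` the walker is at site `j`, the local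
time profile is `u`, no site pushes the walker strongly away from its current position, and
the energy excess over equilibrium is under control. -/
structure IsTame (a b : ℝ) (k : ℕ) (κ ε : ℝ) (n : ℕ) (u : ℤ → ℝ) (j : ℤ) : Prop where
  nonneg : 0 ≤ j
  le : j ≤ k + 1
  support : ∀ e : ℤ, ¬(0 ≤ e ∧ e ≤ k) → u e = 0
  sum : ∑ i ∈ Finset.range (k + 2), u i = n
  left : ∀ m : ℤ, 1 ≤ m → m ≤ k → m < j → -(ε * n + b) ≤ siteDrift a b u m
  right : ∀ m : ℤ, 1 ≤ m → m ≤ k → j < m → siteDrift a b u m ≤ ε * n + b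
  energy_le : energy a b k u - κ * n ^ 2 ≤ (k * ε * n + (2 * k * b + |a + b - κ|)) * n

lemma siteDrift_add_single (a b : ℝ) (u : ℤ → ℝ) (e m : ℤ) :
    siteDrift a b (u + Pi.single e 1) m = siteDrift a b u m + ((if m = e + 2 then a else 0)
      + (if m = e + 1 then b else 0) - (if m = e then b else 0)
      - (if m = e - 1 then a else 0)) := by
  have h1 : m - 2 = e ↔ m = e + 2 := by omega
  have h2 : m - 1 = e ↔ m = e + 1 := by omega
  have h3 : m + 1 = e ↔ m = e - 1 := by omega
  simp only [siteDrift, Pi.add_apply, Pi.single_apply, h1, h2, h3]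
  simp only [mul_add, mul_ite, mul_one, mul_zero]
  ring

lemma IsTame.step {a b κ ε : ℝ} (ha : a < 0) (hb : 0 < b) (hε : 0 < ε) {k n : ℕ} {s u : ℤ → ℝ}
    {j j' e : ℤ} (hs : IsEquilibrium a b k κ s) (hT : IsTame a b k κ ε n u j)
    (hmove : (j' = j + 1 ∧ e = j) ∨ (j' = j - 1 ∧ e = j - 1)) (hj0 : 0 ≤ j') (hjk : j' ≤ k + 1)
    (hup : 1 ≤ j → j ≤ k → ε * n < siteDrift a b u j → j' = j + 1)
    (hdown : 1 ≤ j → j ≤ k → siteDrift a b u j < -(ε * n) → j' = j - 1) :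
    IsTame a b k κ ε (n + 1) (u + Pi.single e 1) j' := by
  have he0 : 0 ≤ e := by have := hT.nonneg; omega
  have hek : e ≤ k := by have := hT.le; omega
  have hu : u (-1) = 0 := hT.support _ (by omega)
  have hu' : u (k + 1) = 0 := hT.support _ (by omega)
  have hn : (0 : ℝ) ≤ ε * n := by positivity
  have hl (m : ℤ) (hm : 1 ≤ m) (hme : m ≤ e) :
      -(ε * n + b) ≤ siteDrift a b u m ∧ (m = e → -(ε * n) ≤ siteDrift a b u m ∨ m < j) := by
    rcases hmove with ⟨h1, h2⟩ | ⟨h1, h2⟩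
    · rcases eq_or_lt_of_le hme with rfl | hlt
      · have : -(ε * n) ≤ siteDrift a b u m := by
          by_contra! hc
          have := hdown (by omega) (by omega) (by rwa [h2] at hc)
          omega
        exact ⟨by linarith, fun _ => Or.inl this⟩
      · exact ⟨hT.left m hm (by omega) (by omega), fun h => by omega⟩
    · exact ⟨hT.left m hm (by omega) (by omega), fun _ => Or.inr (by omega)⟩
  have hr (m : ℤ) (hm : e < m) (hmk : m ≤ k) :
      siteDrift a b u m ≤ ε * n + b ∧
        (m = e + 1 → siteDrift a b u m ≤ ε * n ∨ j < m) := by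
    have hm1 : 1 ≤ m := by omega
    rcases hmove with ⟨h1, h2⟩ | ⟨h1, h2⟩
    · exact ⟨hT.right m hm1 hmk (by omega), fun _ => Or.inr (by omega)⟩
    · rcases eq_or_lt_of_le (show j ≤ m by omega) with rfl | hlt
      · have : siteDrift a b u j ≤ ε * n := by
          by_contra! hc
          have := hup hm1 hmk hc
          omega
        exact ⟨by linarith, fun _ => Or.inl this⟩
      · exact ⟨hT.right m hm1 hmk (by omega), fun h => by omega⟩
  constructor
  · exact hj0
  · exact hjk
  · intro i hi
    rw [Pi.add_apply, hT.support i hi, zero_add, Pi.single_eq_of_ne]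
    rintro rfl
    exact hi ⟨he0, hek⟩
  · have h1 := sum_single_mul k (fun _ => 1) he0 hek
    simp only [mul_one] at h1
    simp only [Pi.add_apply, Finset.sum_add_distrib, hT.sum, h1, Nat.cast_succ]
  · intro m hm hmk hmj
    have hme : m ≤ e := by omega
    rw [siteDrift_add_single, if_neg (by omega), if_neg (by omega)]
    push_cast
    rcases eq_or_lt_of_le hme with rfl | hlt
    · rw [if_pos rfl, if_neg (by omega)]
      rcases (hl m hm le_rfl).2 rfl with h | h
      · linarith
      · omega
    · rw [if_neg hlt.ne]
      have h1 := (hl m hm hme).1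
      split_ifs <;> linarith
  · intro m hm hmk hmj
    have hme : e + 1 ≤ m := by omega
    rw [siteDrift_add_single, if_neg (show m ≠ e by omega), if_neg (show m ≠ e - 1 by omega)]
    push_cast
    rcases eq_or_lt_of_le hme with rfl | hlt
    · rw [if_pos rfl, if_neg (by omega)]
      rcases (hr (e + 1) (by omega) hmk).2 rfl with h | h
      · linarith
      · omega
    · rw [if_neg hlt.ne']
      have h1 := (hr m (by omega) hmk).1
      split_ifs <;> linarith
  · obtain ⟨i, hi0, hik, hi⟩ := hs.exists_stencil_le hu hu' hT.sum
    have hc := le_add_of_increment_le (stencil a b u) (k := k) (B := ε * n + b) (by linarith)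
      he0 hek hi0 hik
      (fun m hm hme => by
        have := (hl m hm hme).1
        rw [siteDrift_eq_stencil_sub] at this
        linarith)
      (fun m hm hmk => by
        have := (hr m hm hmk).1
        rwa [siteDrift_eq_stencil_sub] at this)
    rw [energy_add_single a b k u hu hu' he0 hek]
    have h1 := hT.energy_le
    have h2 := le_abs_self (a + b - κ)
    have h3 : 0 ≤ k * ε := by positivity
    push_cast at hc ⊢
    nlinarith

lemma IsTame.abs_sub_le {a b κ ε ρ : ℝ} (ha : a < 0) {k n : ℕ} {s u : ℤ → ℝ} {j : ℤ}
    (hs : IsEquilibrium a b k κ s) (hT : IsTame a b k κ ε n u j) (hρ : 0 ≤ ρ)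
    (hpos : 0 < b + a * A k)
    (hle : k * ε * n + (2 * k * b + |a + b - κ|) ≤ (b + a * A k) * ρ ^ 2 * n)
    {e : ℤ} (he : 0 ≤ e) (hek : e ≤ k) : |u e - n * s e| ≤ ρ * n := by
  have hu : u (-1) = 0 := hT.support _ (by omega)
  have hu' : u (k + 1) = 0 := hT.support _ (by omega)
  have hn : (0 : ℝ) ≤ n := n.cast_nonneg
  set v : ℤ → ℝ := u + (-(n : ℝ)) • s with hv
  have hve (i : ℤ) : v i = u i - n * s i := by simp [hv]; ring
  have hsE : energy a b k s = κ := by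
    simp only [energy, hs.stencil_eq]
    rw [← Finset.sum_mul, hs.sum, one_mul]
  have hE : energy a b k v = energy a b k u - κ * n ^ 2 := by
    rw [hv, energy_add_smul a b _ k u s hu hu' hs.neg_one hs.last, hsE]
    simp only [hs.stencil_eq]
    rw [← Finset.sum_mul, hT.sum]
    ring
  have hlow := le_energy b ha k v (by rw [hve, hu, hs.neg_one]; ring)
    (by rw [hve, hu', hs.last]; ring)
    (by simp only [hve, Finset.sum_sub_distrib, ← Finset.mul_sum, hs.sum, hT.sum]; ring)
  have hsq : v e ^ 2 ≤ ∑ i ∈ Finset.range (k + 2), v i ^ 2 := by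
    lift e to ℕ using he
    exact Finset.single_le_sum (f := fun i : ℕ => v i ^ 2) (fun i _ => sq_nonneg _)
      (Finset.mem_range.2 (by omega))
  rw [← hve]
  refine abs_le_of_sq_le_sq ?_ (by positivity)
  refine le_of_mul_le_mul_left ?_ hpos
  calc _ ≤ _ := mul_le_mul_of_nonneg_left hsq hpos.le
    _ ≤ _ := hlow
    _ ≤ _ := hE.trans_le hT.energy_le
    _ ≤ _ := mul_le_mul_of_nonneg_right hle hn
    _ = _ := by ring

/-- The local time profile of a path. -/
def pathProfile (x : ℕ → ℤ) (n : ℕ) (e : ℤ) : ℝ :=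
  ((Finset.range n).filter fun m => min (x m) (x (m + 1)) = e).card

lemma pathProfile_succ (x : ℕ → ℤ) (n : ℕ) :
    pathProfile x (n + 1) = pathProfile x n + Pi.single (min (x n) (x (n + 1))) 1 := by
  ext e
  simp only [pathProfile, Finset.range_add_one, Finset.filter_insert, Pi.add_apply,
    Pi.single_apply]
  split_ifs with h1 h2 h2
  · rw [Finset.card_insert_of_notMem (by simp)]
    push_cast
    rfl
  · exact absurd h1.symm h2
  · exact absurd h2.symm h1
  · simp

lemma infinite_visits {x : ℕ → ℤ} (hx : ∀ n, |x (n + 1) - x n| = 1) {e i : ℤ}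
    (hi : i = e ∨ i = e + 1) {c : ℝ} (hc : 0 < c) {n₀ : ℕ}
    (hgrow : ∀ n ≥ n₀, c * n ≤ pathProfile x n e) : {n | x n = i}.Infinite := by
  intro hfin
  obtain ⟨B, hB⟩ := hfin.bddAbove
  have hbound (n : ℕ) : pathProfile x n e ≤ B + 1 := by
    have : ((Finset.range n).filter fun m => min (x m) (x (m + 1)) = e)
        ⊆ Finset.range (B + 1) := by
      intro m hm
      have hmin := (Finset.mem_filter.1 hm).2
      have hstep := hx m
      rw [abs_eq zero_le_one] at hstep
      have : x m = i ∨ x (m + 1) = i := by omega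
      rw [Finset.mem_range]
      rcases this with h | h
      · exact Nat.lt_succ_of_le (hB h)
      · have := hB h
        omega
    have := Finset.card_le_card this
    rw [Finset.card_range] at this
    unfold pathProfile
    exact_mod_cast this
  obtain ⟨N, hN⟩ := exists_nat_gt ((B + 1) / c)
  have h1 := hgrow (max N n₀) (le_max_right _ _)
  have h2 := hbound (max N n₀)
  rw [div_lt_iff₀ hc] at hN
  have h3 : (N : ℝ) ≤ (max N n₀ : ℕ) := by exact_mod_cast le_max_left _ _
  nlinarith

/-- A path that respects the drift, up to a linear tolerance, and is confined to `0, …, k + 1` for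
long enough remains there and visits all these sites infinitely often. -/
lemma exists_confinement {a b : ℝ} (ha : a < 0) (hb : 0 < b) {k : ℕ} (hk : 1 ≤ k)
    (hab : b / |a| ∈ Set.Ioo (A k) (A (k + 1))) :
    ∃ ε > 0, ∃ n₁ : ℕ, ∀ n₀ ≥ n₁, ∀ x : ℕ → ℤ, x 0 = 0 → (∀ n, |x (n + 1) - x n| = 1) →
      (∀ n < n₀, 0 ≤ x (n + 1) ∧ x (n + 1) ≤ k + 1) →
      (∀ n, n₀ ≤ n ∨ (1 ≤ x n ∧ x n ≤ k) →
        (ε * n < siteDrift a b (pathProfile x n) (x n) → x (n + 1) = x n + 1) ∧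
        (siteDrift a b (pathProfile x n) (x n) < -(ε * n) → x (n + 1) = x n - 1)) →
      (∀ n, x n ∈ Set.Icc (0 : ℤ) (k + 1)) ∧
        ∀ i ∈ Set.Icc (0 : ℤ) (k + 1), {n | x n = i}.Infinite := by
  obtain ⟨κ, s, hs⟩ := exists_isEquilibrium ha hk hab
  have hk' : (1 : ℝ) ≤ k := by exact_mod_cast hk
  set l := b + a * A k with hl
  have hlpos : 0 < l := by
    have := hab.1
    rw [abs_of_neg ha, lt_div_iff₀ (by linarith)] at this
    linarith
  obtain ⟨i₀, hi₀, hmin⟩ := Finset.exists_min_image (Finset.Icc (0 : ℤ) k) s ⟨0, by simp⟩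
  rw [Finset.mem_Icc] at hi₀
  have hmpos := hs.pos i₀ hi₀.1 hi₀.2
  set μ := s i₀
  set η := min (-b * s 0 - a * s 1) (-b * s k - a * s (k - 1)) with hη
  have hηpos : 0 < η := lt_min hs.left hs.right
  have hη1 : η ≤ -b * s 0 - a * s 1 := min_le_left _ _
  have hη2 : η ≤ -b * s k - a * s (k - 1) := min_le_right _ _
  have hba : 0 < b - a := by linarith
  set ρ := min (μ / 2) (η / (4 * (b - a))) with hρ
  have hρpos : 0 < ρ := by positivity
  have hρ1 : ρ ≤ μ / 2 := min_le_left _ _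
  have hρ2 : ρ * (4 * (b - a)) ≤ η := by
    rw [← le_div_iff₀ (by positivity)]
    exact min_le_right _ _
  set ε := min (η / 4) (l * ρ ^ 2 / (2 * k)) with hε
  have hεpos : 0 < ε := by positivity
  have hε1 : ε ≤ η / 4 := min_le_left _ _
  have hε2 : ε * (2 * k) ≤ l * ρ ^ 2 := by
    rw [← le_div_iff₀ (by positivity)]
    exact min_le_right _ _
  set C := 2 * k * b + |a + b - κ| with hC
  obtain ⟨n₁, hn₁⟩ := exists_nat_ge (2 * C / (l * ρ ^ 2))
  rw [div_le_iff₀ (by positivity)] at hn₁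
  refine ⟨ε, hεpos, n₁ + 1, fun n₀ hn₀ x hx0 hx hconf hrule => ?_⟩
  have hclose (n : ℕ) (hn : n₀ ≤ n) (hT : IsTame a b k κ ε n (pathProfile x n) (x n)) {e : ℤ}
      (he : 0 ≤ e) (hek : e ≤ k) : |pathProfile x n e - n * s e| ≤ ρ * n := by
    refine hT.abs_sub_le ha hs hρpos.le hlpos ?_ he hek
    have h1 : (n₁ : ℝ) ≤ n := by exact_mod_cast (by omega : n₁ ≤ n)
    have h2 : 0 < l * ρ ^ 2 := by positivity
    have h3 : (0 : ℝ) ≤ n := n.cast_nonneg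
    nlinarith
  have htame (n : ℕ) : IsTame a b k κ ε n (pathProfile x n) (x n) := by
    induction n with
    | zero =>
      have hzero : pathProfile x 0 = 0 := by
        ext e
        simp [pathProfile]
      rw [hx0, hzero]
      constructor
      · exact le_rfl
      · positivity
      · simp
      · simp
      · intros
        omega
      · intros
        simp [siteDrift, hb.le]
      · simp [energy]
    | succ n ih =>
      have hstep := hx n
      rw [abs_eq zero_le_one] at hstep
      have hmem : 0 ≤ x (n + 1) ∧ x (n + 1) ≤ k + 1 := by
        rcases lt_or_ge n n₀ with hlt | hge
        · exact hconf n hlt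
        · have hnpos : (0 : ℝ) < n := by exact_mod_cast (by omega : 0 < n)
          have hR := hrule n (Or.inl hge)
          have h0 := ih.nonneg
          have hk1 := ih.le
          constructor
          · by_contra! hc
            have hj : x n = 0 := by omega
            have hd : ε * n < siteDrift a b (pathProfile x n) (x n) := by
              have e0 := abs_le.1 (hclose n hge ih (e := 0) le_rfl (by omega))
              have e1 := abs_le.1 (hclose n hge ih (e := 1) (by omega) (by omega))
              rw [hj, siteDrift, ih.support (0 - 2) (by omega), ih.support (0 - 1) (by omega),
                zero_add]
              nlinarith
            have := hR.1 hd
            omega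
          · by_contra! hc
            have hj : x n = k + 1 := by omega
            have hd : siteDrift a b (pathProfile x n) (x n) < -(ε * n) := by
              have e0 := abs_le.1 (hclose n hge ih (e := k) (by omega) (by omega))
              have e1 := abs_le.1 (hclose n hge ih (e := k - 1) (by omega) (by omega))
              rw [hj, siteDrift, ih.support (k + 1) (by omega),
                ih.support (k + 1 + 1) (by omega), add_sub_cancel_right,
                show (k : ℤ) + 1 - 2 = k - 1 by ring]
              nlinarith
            have := hR.2 hd
            omega
      rw [pathProfile_succ]
      refine ih.step ha hb hεpos hs ?_ hmem.1 hmem.2 ?_ ?_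
      · omega
      · exact fun h1 h2 => (hrule n (Or.inr ⟨h1, h2⟩)).1
      · exact fun h1 h2 => (hrule n (Or.inr ⟨h1, h2⟩)).2
  refine ⟨fun n => ⟨(htame n).nonneg, (htame n).le⟩, fun i hi => ?_⟩
  obtain ⟨e, he0, hek, hie⟩ : ∃ e : ℤ, 0 ≤ e ∧ e ≤ k ∧ (i = e ∨ i = e + 1) := by
    obtain ⟨h1, h2⟩ := hi
    rcases eq_or_lt_of_le h1 with h | h
    · exact ⟨0, by omega, by omega, by omega⟩
    · exact ⟨i - 1, by omega, by omega, by omega⟩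
  refine infinite_visits hx hie (half_pos hmpos) (n₀ := n₀) fun n hn => ?_
  have h1 := abs_le.1 (hclose n hn (htame n) he0 hek)
  have h2 := hmin e (Finset.mem_Icc.2 ⟨he0, hek⟩)
  have h3 : (0 : ℝ) ≤ n := n.cast_nonneg
  nlinarith

lemma Dab_eq_siteDrift {Ω : Type*} (a b : ℝ) (X : ℕ → Ω → ℤ) (n : ℕ) (ω : Ω) :
    Dab a b X n ω = siteDrift a b (pathProfile (fun m => X m ω) n) (X n ω) := by
  simp only [Dab, siteDrift, shiftedProfile, locTime, pathProfile, sub_eq_add_neg, add_zero]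

lemma measurable_Dab {Ω : Type*} [MeasurableSpace Ω] (a b : ℝ) {X : ℕ → Ω → ℤ} {n : ℕ}
    (hX : ∀ m ≤ n, Measurable (X m)) : Measurable (Dab a b X n) := by
  have hloc (i : ℤ) : Measurable fun ω => (shiftedProfile X n i ω : ℝ) := by
    simp only [shiftedProfile, locTime, Finset.card_filter, Nat.cast_sum]
    refine Finset.measurable_sum _ fun m hm => ?_
    have hmn := Finset.mem_range.1 hm
    have hset : MeasurableSet {ω | min (X m ω) (X (m + 1) ω) = X n ω + i} :=
      measurableSet_eq_fun ((hX m hmn.le).min (hX (m + 1) hmn))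
        ((hX n le_rfl).add measurable_const)
    simp only [Nat.cast_ite]
    exact Measurable.ite hset measurable_const measurable_const
  unfold Dab
  exact ((((hloc _).const_mul _).add ((hloc _).const_mul _)).sub ((hloc _).const_mul _)).sub
    ((hloc _).const_mul _)

lemma measurable_walkFiltration {Ω : Type*} (X : ℕ → Ω → ℤ) {m n : ℕ} (h : m ≤ n) :
    Measurable[walkFiltration X n] (X m) := by
  refine Measurable.mono (comap_measurable (X m)) ?_ le_rfl
  exact le_iSup₂_of_le m (Finset.mem_range.2 (Nat.lt_succ_of_le h)) le_rfl

lemma walkFiltration_le {Ω : Type*} [m₀ : MeasurableSpace Ω] {X : ℕ → Ω → ℤ}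
    (hX : ∀ n, Measurable (X n)) (n : ℕ) : walkFiltration X n ≤ m₀ :=
  iSup₂_le fun m _ => (hX m).comap_le

lemma walkF_pos (y : ℝ) : 0 < walkF y := by
  unfold walkF
  positivity

lemma one_sub_walkF (y : ℝ) : 1 - walkF y = walkF (-y) := by
  unfold walkF
  have : Real.exp y + Real.exp (-y) ≠ 0 := by positivity
  rw [neg_neg, add_comm (Real.exp (-y)), one_sub_div this, add_sub_cancel_left]

lemma walkF_le_exp (y : ℝ) : walkF y ≤ Real.exp (2 * y) := by
  unfold walkF
  rw [div_le_iff₀ (by positivity), mul_add, ← Real.exp_add (2 * y) (-y),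
    show 2 * y + -y = y by ring]
  have : 0 < Real.exp (2 * y) * Real.exp y := by positivity
  linarith

lemma measure_ne_zero_of_setIntegral {Ω : Type*} [MeasurableSpace Ω] {μ : Measure Ω}
    {B E : Set Ω} {f : Ω → ℝ} (hf : Integrable f μ)
    (hpos : ∀ ω, 0 < f ω) (hμB : μ B ≠ 0) (h : ∫ ω in B, f ω ∂μ = μ.real E) : μ E ≠ 0 := by
  have hint : 0 < ∫ ω in B, f ω ∂μ := by
    rw [setIntegral_pos_iff_support_of_nonneg_ae (ae_of_all _ fun ω => (hpos ω).le)
      hf.integrableOn]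
    have : Function.support f = Set.univ := Set.eq_univ_of_forall fun ω => (hpos ω).ne'
    rw [this, Set.univ_inter]
    exact pos_iff_ne_zero.2 hμB
  intro hE
  rw [h, measureReal_def, hE] at hint
  exact lt_irrefl _ hint

lemma measure_le_of_setIntegral {Ω : Type*} [MeasurableSpace Ω] {μ : Measure Ω}
    [IsFiniteMeasure μ] {B E : Set Ω} {f : Ω → ℝ} {q : ℝ} (hf : Integrable f μ)
    (hB : MeasurableSet B) (hq : 0 ≤ q) (hle : ∀ ω ∈ B, f ω ≤ q)
    (h : ∫ ω in B, f ω ∂μ = μ.real E) : μ E ≤ ENNReal.ofReal q * μ B := by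
  have h1 : ∫ ω in B, f ω ∂μ ≤ ∫ _ in B, q ∂μ :=
    setIntegral_mono_on hf.integrableOn (integrable_const q).integrableOn hB hle
  rw [h, setIntegral_const, smul_eq_mul] at h1
  rw [← ENNReal.ofReal_toReal (measure_ne_top μ E), ← ENNReal.ofReal_toReal (measure_ne_top μ B),
    ← ENNReal.ofReal_mul hq]
  refine ENNReal.ofReal_le_ofReal ?_
  rw [mul_comm]
  exact h1

/-- The first `n` steps of the walk follow the drift and are reflected at `0` and `k + 1`. -/
def greedySet {Ω : Type*} (a b : ℝ) (X : ℕ → Ω → ℤ) (k n : ℕ) : Set Ω :=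
  {ω | ∀ m < n, X (m + 1) ω = X m ω + 1 ↔ X m ω = 0 ∨ (X m ω ≠ k + 1 ∧ 0 ≤ Dab a b X m ω)}

lemma measurableSet_upward {Ω : Type*} (a b : ℝ) (X : ℕ → Ω → ℤ) (k : ℕ) {m n : ℕ} (h : m ≤ n) :
    MeasurableSet[walkFiltration X n]
      {ω | X m ω = 0 ∨ (X m ω ≠ k + 1 ∧ 0 ≤ Dab a b X m ω)} := by
  let := walkFiltration X n
  have hX (i : ℕ) (hi : i ≤ n) : Measurable (X i) := measurable_walkFiltration X hi
  refine (measurableSet_eq_fun (hX m h) measurable_const).union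
    ((measurableSet_eq_fun (hX m h) measurable_const).compl.inter ?_)
  exact measurableSet_le measurable_const (measurable_Dab a b fun i hi => hX i (hi.trans h))

lemma measurableSet_greedySet {Ω : Type*} (a b : ℝ) (X : ℕ → Ω → ℤ) (k : ℕ) {m n : ℕ}
    (h : m ≤ n) :
    MeasurableSet[walkFiltration X n] (greedySet a b X k m) := by
  let := walkFiltration X n
  have hX (i : ℕ) (hi : i ≤ n) : Measurable (X i) := measurable_walkFiltration X hi
  have : greedySet a b X k m = ⋂ i, ⋂ (_ : i < m), {ω | X (i + 1) ω = X i ω + 1 ↔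
      X i ω = 0 ∨ (X i ω ≠ k + 1 ∧ 0 ≤ Dab a b X i ω)} := by
    ext ω
    simp [greedySet]
  rw [this]
  refine MeasurableSet.iInter fun i => MeasurableSet.iInter fun hi => ?_
  exact MeasurableSet.iff
    (measurableSet_eq_fun (hX _ (by omega)) ((hX i (by omega)).add measurable_const))
    (measurableSet_upward a b X k (by omega))

lemma ite_up_eq_indicator {Ω : Type*} (X : ℕ → Ω → ℤ) (n : ℕ) :
    (fun ω => if X (n + 1) ω = X n ω + 1 then (1 : ℝ) else 0)
      = Set.indicator {ω | X (n + 1) ω = X n ω + 1} fun _ => 1 := by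
  ext ω
  simp [Set.indicator_apply]

lemma integrable_walkF {Ω : Type*} [MeasurableSpace Ω] {μ : Measure Ω} {X : ℕ → Ω → ℤ} {a b : ℝ}
    {n : ℕ}
    (hdrive : μ[(fun ω => if X (n + 1) ω = X n ω + 1 then (1 : ℝ) else 0) |
      walkFiltration X n] =ᵐ[μ] fun ω => walkF (Dab a b X n ω)) :
    Integrable (fun ω => walkF (Dab a b X n ω)) μ :=
  integrable_condExp.congr hdrive

section Walk

variable {Ω : Type*} [MeasurableSpace Ω] {μ : Measure Ω} [IsProbabilityMeasure μ]
  {X : ℕ → Ω → ℤ} {a b : ℝ} {n : ℕ} {B : Set Ω}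

lemma measurableSet_up (hmeas : ∀ n, Measurable (X n)) (n : ℕ) :
    MeasurableSet {ω | X (n + 1) ω = X n ω + 1} :=
  measurableSet_eq_fun (hmeas _) ((hmeas _).add measurable_const)

lemma integrable_up (hmeas : ∀ n, Measurable (X n)) (n : ℕ) :
    Integrable (fun ω => if X (n + 1) ω = X n ω + 1 then (1 : ℝ) else 0) μ := by
  rw [ite_up_eq_indicator]
  exact (integrable_const (1 : ℝ)).indicator (measurableSet_up hmeas n)

lemma setIntegral_walkF (hmeas : ∀ n, Measurable (X n))
    (hdrive : μ[(fun ω => if X (n + 1) ω = X n ω + 1 then (1 : ℝ) else 0) |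
      walkFiltration X n] =ᵐ[μ] fun ω => walkF (Dab a b X n ω))
    (hB : MeasurableSet[walkFiltration X n] B) :
    ∫ ω in B, walkF (Dab a b X n ω) ∂μ = μ.real (B ∩ {ω | X (n + 1) ω = X n ω + 1}) := by
  have hm := walkFiltration_le hmeas n
  rw [← setIntegral_congr_ae (hm _ hB) (hdrive.mono fun ω h _ => h),
    setIntegral_condExp hm (integrable_up hmeas n) hB, ite_up_eq_indicator,
    setIntegral_indicator (measurableSet_up hmeas n), setIntegral_const, smul_eq_mul, mul_one]

lemma setIntegral_walkF_neg (hmeas : ∀ n, Measurable (X n))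
    (hdrive : μ[(fun ω => if X (n + 1) ω = X n ω + 1 then (1 : ℝ) else 0) |
      walkFiltration X n] =ᵐ[μ] fun ω => walkF (Dab a b X n ω))
    (hB : MeasurableSet[walkFiltration X n] B) :
    ∫ ω in B, walkF (-Dab a b X n ω) ∂μ = μ.real (B \ {ω | X (n + 1) ω = X n ω + 1}) := by
  simp only [← one_sub_walkF]
  rw [integral_sub (integrable_const _).integrableOn (integrable_walkF hdrive).integrableOn,
    setIntegral_walkF hmeas hdrive hB, setIntegral_const, smul_eq_mul, mul_one,
    ← measureReal_inter_add_sdiff (s := B) (measurableSet_up hmeas n), add_sub_cancel_left]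

lemma integrable_walkF_neg (hdrive : μ[(fun ω => if X (n + 1) ω = X n ω + 1 then (1 : ℝ) else 0) |
      walkFiltration X n] =ᵐ[μ] fun ω => walkF (Dab a b X n ω)) :
    Integrable (fun ω => walkF (-Dab a b X n ω)) μ := by
  simp only [← one_sub_walkF]
  exact (integrable_const _).sub (integrable_walkF hdrive)

lemma measure_greedySet_ne_zero (hmeas : ∀ n, Measurable (X n))
    (hdrive : ∀ n, μ[(fun ω => if X (n + 1) ω = X n ω + 1 then (1 : ℝ) else 0) |
      walkFiltration X n] =ᵐ[μ] fun ω => walkF (Dab a b X n ω)) (k n : ℕ) :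
    μ (greedySet a b X k n) ≠ 0 := by
  induction n with
  | zero => simp [greedySet]
  | succ n ih =>
    set G := greedySet a b X k n
    set P := {ω | X n ω = 0 ∨ (X n ω ≠ k + 1 ∧ 0 ≤ Dab a b X n ω)}
    have hle := walkFiltration_le hmeas n
    have hG : MeasurableSet[walkFiltration X n] G := measurableSet_greedySet a b X k le_rfl
    have hP : MeasurableSet[walkFiltration X n] P := measurableSet_upward a b X k le_rfl
    have hsub1 : (G ∩ P) ∩ {ω | X (n + 1) ω = X n ω + 1} ⊆ greedySet a b X k (n + 1) := by
      rintro ω ⟨⟨hω, hωP⟩, hup⟩ m hm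
      rcases Nat.lt_succ_iff_lt_or_eq.1 hm with h | rfl
      · exact hω m h
      · exact ⟨fun _ => hωP, fun _ => hup⟩
    have hsub2 : (G \ P) \ {ω | X (n + 1) ω = X n ω + 1} ⊆ greedySet a b X k (n + 1) := by
      rintro ω ⟨⟨hω, hωP⟩, hup⟩ m hm
      rcases Nat.lt_succ_iff_lt_or_eq.1 hm with h | rfl
      · exact hω m h
      · exact ⟨fun h => absurd h hup, fun h => absurd h hωP⟩
    have hcase : μ (G ∩ P) ≠ 0 ∨ μ (G \ P) ≠ 0 := by
      by_contra! hc
      rw [← measure_inter_add_sdiff G (hle _ hP), hc.1, hc.2, add_zero] at ih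
      exact ih rfl
    rcases hcase with h | h
    · have := measure_ne_zero_of_setIntegral (integrable_walkF (hdrive n))
        (fun ω => walkF_pos _) h
        (setIntegral_walkF hmeas (hdrive n) (hG.inter hP))
      exact fun h0 => this (measure_mono_null hsub1 h0)
    · have := measure_ne_zero_of_setIntegral (integrable_walkF_neg (hdrive n))
        (fun ω => walkF_pos _) h
        (setIntegral_walkF_neg hmeas (hdrive n) (hG.diff hP))
      exact fun h0 => this (measure_mono_null hsub2 h0)

/-- The `n`-th step of the walk goes against a drift larger than `ε * n`. -/
def contrarySet (a b : ℝ) (X : ℕ → Ω → ℤ) (ε : ℝ) (n : ℕ) : Set Ω :=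
  ({ω | Dab a b X n ω < -(ε * n)} ∩ {ω | X (n + 1) ω = X n ω + 1}) ∪
    ({ω | ε * n < Dab a b X n ω} \ {ω | X (n + 1) ω = X n ω + 1})

lemma measure_inter_contrarySet_le (hmeas : ∀ n, Measurable (X n))
    (hdrive : μ[(fun ω => if X (n + 1) ω = X n ω + 1 then (1 : ℝ) else 0) |
      walkFiltration X n] =ᵐ[μ] fun ω => walkF (Dab a b X n ω))
    (hB : MeasurableSet[walkFiltration X n] B) {ε : ℝ} (hε : 0 < ε) :
    μ (B ∩ contrarySet a b X ε n) ≤ ENNReal.ofReal (Real.exp (-(2 * ε)) ^ n) * μ B := by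
  have hle := walkFiltration_le hmeas n
  have hD : Measurable[walkFiltration X n] (Dab a b X n) :=
    @measurable_Dab Ω (walkFiltration X n) a b X n fun m hm => measurable_walkFiltration X hm
  set N := {ω | Dab a b X n ω < -(ε * n)}
  set P := {ω | ε * n < Dab a b X n ω}
  have hN : MeasurableSet[walkFiltration X n] N := hD measurableSet_Iio
  have hP : MeasurableSet[walkFiltration X n] P := hD measurableSet_Ioi
  have hexp : Real.exp (2 * -(ε * n)) = Real.exp (-(2 * ε)) ^ n := by
    rw [← Real.exp_nat_mul]
    ring_nf
  have h1 := measure_le_of_setIntegral (q := Real.exp (-(2 * ε)) ^ n) (integrable_walkF hdrive)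
    (hle _ (hB.inter hN)) (by positivity) (fun ω hω => by
      refine (walkF_le_exp _).trans ?_
      rw [← hexp]
      exact Real.exp_le_exp.2 (mul_le_mul_of_nonneg_left (le_of_lt hω.2) two_pos.le))
    (setIntegral_walkF hmeas hdrive (hB.inter hN))
  have h2 := measure_le_of_setIntegral (q := Real.exp (-(2 * ε)) ^ n)
    (integrable_walkF_neg hdrive) (hle _ (hB.inter hP)) (by positivity) (fun ω hω => by
      refine (walkF_le_exp _).trans ?_
      rw [← hexp]
      exact Real.exp_le_exp.2 (mul_le_mul_of_nonneg_left (neg_le_neg (le_of_lt hω.2)) two_pos.le))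
    (setIntegral_walkF_neg hmeas hdrive (hB.inter hP))
  have hdisj : Disjoint (B ∩ N) (B ∩ P) := by
    rw [Set.disjoint_left]
    rintro ω ⟨_, h3⟩ ⟨_, h4⟩
    have h3' : Dab a b X n ω < -(ε * n) := h3
    have h4' : ε * n < Dab a b X n ω := h4
    have : 0 ≤ ε * n := by positivity
    linarith
  calc μ (B ∩ contrarySet a b X ε n)
      ≤ μ ((B ∩ N ∩ {ω | X (n + 1) ω = X n ω + 1}) ∪
          ((B ∩ P) \ {ω | X (n + 1) ω = X n ω + 1})) := by
        refine measure_mono ?_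
        rintro ω ⟨hω, h | h⟩
        · exact Or.inl ⟨⟨hω, h.1⟩, h.2⟩
        · exact Or.inr ⟨⟨hω, h.1⟩, h.2⟩
    _ ≤ _ := measure_union_le _ _
    _ ≤ _ := add_le_add h1 h2
    _ = ENNReal.ofReal (Real.exp (-(2 * ε)) ^ n) * μ ((B ∩ N) ∪ (B ∩ P)) := by
        rw [measure_union hdisj (hle _ (hB.inter hP)), mul_add]
    _ ≤ _ := by
        gcongr
        exact Set.union_subset Set.inter_subset_left Set.inter_subset_left

lemma measure_greedySet_diff_pos (hmeas : ∀ n, Measurable (X n))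
    (hdrive : ∀ n, μ[(fun ω => if X (n + 1) ω = X n ω + 1 then (1 : ℝ) else 0) |
      walkFiltration X n] =ᵐ[μ] fun ω => walkF (Dab a b X n ω)) (k : ℕ) {ε : ℝ} (hε : 0 < ε)
    (n₁ : ℕ) : ∃ n₀ ≥ n₁,
      0 < μ (greedySet a b X k n₀ \ ⋃ n, contrarySet a b X ε (n + n₀)) := by
  set q := Real.exp (-(2 * ε)) with hq
  have hq0 : 0 ≤ q := (Real.exp_pos _).le
  have hq1 : q < 1 := Real.exp_lt_one_iff.2 (by linarith)
  have hsum := summable_geometric_of_lt_one hq0 hq1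
  obtain ⟨n₀, hn₀, hlt⟩ := ((eventually_ge_atTop n₁).and
    ((tendsto_sum_nat_add fun n => q ^ n).eventually_lt_const one_pos)).exists
  refine ⟨n₀, hn₀, ?_⟩
  set G := greedySet a b X k n₀ with hG
  set U := ⋃ n, contrarySet a b X ε (n + n₀)
  have hGne : μ G ≠ 0 := measure_greedySet_ne_zero hmeas hdrive k n₀
  have hU : μ (G ∩ U) < μ G := by
    calc μ (G ∩ U) ≤ ∑' n, μ (G ∩ contrarySet a b X ε (n + n₀)) := by
          rw [Set.inter_iUnion]
          exact measure_iUnion_le _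
      _ ≤ ∑' n, ENNReal.ofReal (q ^ (n + n₀)) * μ G := by
          refine ENNReal.tsum_le_tsum fun n => ?_
          exact measure_inter_contrarySet_le hmeas (hdrive _)
            (measurableSet_greedySet a b X k (Nat.le_add_left _ _)) hε
      _ = ENNReal.ofReal (∑' n, q ^ (n + n₀)) * μ G := by
          rw [ENNReal.tsum_mul_right, ENNReal.ofReal_tsum_of_nonneg (fun n => by positivity)
            ((summable_nat_add_iff n₀).2 hsum)]
      _ < 1 * μ G := by
          refine ENNReal.mul_lt_mul_left hGne (measure_ne_top _ _) ?_
          exact ENNReal.ofReal_lt_one.2 hlt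
      _ = μ G := one_mul _
  rw [pos_iff_ne_zero]
  intro h0
  have := measure_le_inter_add_sdiff μ G U
  rw [h0, add_zero] at this
  exact absurd hU (not_lt.2 this)

end Walk

/-- if `a < 0 < b` and `b/|a| ∈ (A_k, A_{k+1})`, then with positive probability
the walk driven by `D^{a,b}` eventually remains in a set of `k+2` consecutive sites and
visits each of these sites infinitely often. -/
theorem stmt0 {Ω : Type*} [MeasurableSpace Ω] (μ : Measure Ω) [IsProbabilityMeasure μ]
    (X : ℕ → Ω → ℤ) (hmeas : ∀ n, Measurable (X n))
    (hX0 : ∀ᵐ ω ∂μ, X 0 ω = 0)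
    (hstep : ∀ n, ∀ᵐ ω ∂μ, |X (n + 1) ω - X n ω| = 1)
    (a b : ℝ) (ha : a < 0) (hb : 0 < b)
    (k : ℕ) (hk : 1 ≤ k) (hab : b / |a| ∈ Set.Ioo (A k) (A (k + 1)))
    (hdrive : ∀ n,
      μ[(fun ω => if X (n + 1) ω = X n ω + 1 then (1 : ℝ) else 0) | walkFiltration X n]
        =ᵐ[μ] fun ω => walkF (Dab a b X n ω)) :
    0 < μ {ω | ∃ x : ℤ, ∃ n₀ : ℕ,
        (∀ n ≥ n₀, X n ω ∈ Set.Icc x (x + k + 1)) ∧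
        (∀ i ∈ Set.Icc x (x + k + 1), {n : ℕ | X n ω = i}.Infinite)} := by
  obtain ⟨ε, hε, n₁, hdet⟩ := exists_confinement ha hb hk hab
  obtain ⟨n₀, hn₀, hpos⟩ := measure_greedySet_diff_pos hmeas hdrive k hε n₁
  refine hpos.trans_le (measure_mono_ae ?_)
  filter_upwards [hX0, ae_all_iff.2 hstep] with ω h0 hs hω
  obtain ⟨hG, hU⟩ := hω
  have hs' (n : ℕ) : X (n + 1) ω = X n ω + 1 ∨ X (n + 1) ω = X n ω - 1 := by
    have := hs n
    rw [abs_eq zero_le_one] at this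
    omega
  have hconf : ∀ n ≤ n₀, 0 ≤ X n ω ∧ X n ω ≤ k + 1 := by
    intro n
    induction n with
    | zero =>
      intro _
      rw [h0]
      omega
    | succ n ih =>
      intro hn
      obtain ⟨h1, h2⟩ := ih (by omega)
      have hg := hG n hn
      rcases hs' n with h | h
      · have : X n ω ≠ k + 1 := by
          rcases hg.1 h with h3 | h3
          · omega
          · exact h3.1
        omega
      · have : X n ω ≠ 0 := fun h3 => by
          have := hg.2 (Or.inl h3)
          omega
        omega
  obtain ⟨hmem, hinf⟩ := hdet n₀ hn₀ (fun n => X n ω) h0 hs (fun n hn => hconf (n + 1) hn) (by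
    intro n hn
    rw [← Dab_eq_siteDrift]
    rcases lt_or_ge n n₀ with hlt | hge
    · obtain ⟨h1, h2⟩ := hn.resolve_left (by omega)
      have hg := hG n hlt
      have hnε : 0 ≤ ε * n := by positivity
      refine ⟨fun h => hg.2 (Or.inr ⟨by omega, by linarith⟩), fun h => ?_⟩
      refine (hs' n).resolve_left fun hup => ?_
      rcases hg.1 hup with h3 | h3
      · omega
      · linarith [h3.2]
    · have hnot : ω ∉ contrarySet a b X ε n := fun hc =>
        hU (Set.mem_iUnion.2 ⟨n - n₀, by rwa [Nat.sub_add_cancel hge]⟩)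
      refine ⟨fun h => ?_, fun h => ?_⟩
      · by_contra hc
        exact hnot (Or.inr ⟨h, hc⟩)
      · exact (hs' n).resolve_left fun hup => hnot (Or.inl ⟨h, hup⟩))
  refine ⟨0, 0, fun n _ => ?_, fun i hi => hinf i ?_⟩
  · simpa using hmem n
  · simpa using hi
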